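/- Suppose the real eigenvalue sequence satisfies 0 < E_1 < E_2 < ⋯ and E_n ≤ C·n^α for all n, for some α > 0 and C > 0. Let H^{−1/2} denote the bounded operator Σ_n E_n^{−1/2} P_n and Q_n := I − P_n. Let W(t) be a strongly C¹ family of bounded self-adjoint operators such that for some μ > 1/2 and c > 0 one has ‖P_n W(t) Q_n H^{−1/2}‖ ≤ c·n^{−μ−α/2} for all n ≥ 1 and all t. Then for every propagator U(t,s) for H+W(t), the operator U(t,0) maps Q_H into itself for every t, and there exists c₃ > 0 such that for all ψ ∈ Q_H and all t ≥ 1: Σ_n E_n‖P_n U(t,0)ψ‖² ≤ c₃ (t^{2α/(2μ−1)}‖ψ‖² + Σ_n E_n‖P_nψ‖²). -/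

import Mathlib

noncomputable section

open ContinuousLinearMap

variable {𝓗 : Type*} [NormedAddCommGroup 𝓗] [InnerProductSpace ℂ 𝓗] [CompleteSpace 𝓗]

/-- `⟨x⟩ := max {1, |x|}`. -/
def jap (x : ℝ) : ℝ := max 1 |x|

/-- `(Pₙ)_{n≥1}` is a family of mutually orthogonal nonzero orthogonal projections
with `Σₙ Pₙ = I` in the strong sense. -/
def ProjFamily (P : ℕ+ → 𝓗 →L[ℂ] 𝓗) : Prop :=
  (∀ n, IsSelfAdjoint (P n)) ∧ (∀ n, (P n).comp (P n) = P n) ∧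
  (∀ m n, m ≠ n → (P m).comp (P n) = 0) ∧ (∀ n, P n ≠ 0) ∧
  (∀ ψ : 𝓗, HasSum (fun n => P n ψ) ψ)

/-- The quantity `⟨m-n⟩^p · max{m,n}^(2δ) · ‖Pₘ A Pₙ‖`; the norm `‖A‖_{p,δ}` is its
supremum over `m, n ≥ 1`. -/
def wnorm (P : ℕ+ → 𝓗 →L[ℂ] 𝓗) (p δ : ℝ) (A : 𝓗 →L[ℂ] 𝓗) (m n : ℕ+) : ℝ :=
  jap (((m : ℕ) : ℝ) - ((n : ℕ) : ℝ)) ^ p * (((max m n : ℕ+) : ℕ) : ℝ) ^ (2 * δ) *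
    ‖(P m).comp (A.comp (P n))‖

/-- `A` is diagonal with respect to the family `P`. -/
def IsDiag (P : ℕ+ → 𝓗 →L[ℂ] 𝓗) (A : 𝓗 →L[ℂ] 𝓗) : Prop :=
  ∀ m n, m ≠ n → (P m).comp (A.comp (P n)) = 0

/-- `Dom(H) = {ψ : Σₙ Eₙ²‖Pₙψ‖² < ∞}`. -/
def HDom (P : ℕ+ → 𝓗 →L[ℂ] 𝓗) (E : ℕ+ → ℝ) : Set 𝓗 :=
  {ψ | Summable fun n => (E n) ^ 2 * ‖P n ψ‖ ^ 2}

/-- The form domain `Q_H = {ψ : Σₙ Eₙ‖Pₙψ‖² < ∞}`. -/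
def QDom (P : ℕ+ → 𝓗 →L[ℂ] 𝓗) (E : ℕ+ → ℝ) : Set 𝓗 :=
  {ψ | Summable fun n => E n * ‖P n ψ‖ ^ 2}

/-- `h = Hψ`, i.e. `h = Σₙ Eₙ Pₙ ψ`. -/
def IsHSum (P : ℕ+ → 𝓗 →L[ℂ] 𝓗) (E : ℕ+ → ℝ) (ψ h : 𝓗) : Prop :=
  HasSum (fun n => (E n : ℂ) • P n ψ) h

/-- `U` is unitary. -/
def IsUnitaryOp (U : 𝓗 →L[ℂ] 𝓗) : Prop := U * star U = 1 ∧ star U * U = 1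

/-- A family of bounded operators which is `C¹` in the strong sense. -/
def StrongC1 (V : ℝ → 𝓗 →L[ℂ] 𝓗) : Prop := ∀ ψ : 𝓗, ContDiff ℝ 1 fun t => V t ψ

/-- `U(t,s)` is a propagator for `H + V(t)`. -/
def IsPropagator (P : ℕ+ → 𝓗 →L[ℂ] 𝓗) (E : ℕ+ → ℝ) (V : ℝ → 𝓗 →L[ℂ] 𝓗)
    (U : ℝ → ℝ → 𝓗 →L[ℂ] 𝓗) : Prop :=
  (∀ t s, IsUnitaryOp (U t s)) ∧
  (∀ ψ : 𝓗, Continuous fun ts : ℝ × ℝ => U ts.1 ts.2 ψ) ∧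
  (∀ t, U t t = 1) ∧
  (∀ t s r, (U t s).comp (U s r) = U t r) ∧
  (∀ t s, ⇑(U t s) '' HDom P E = HDom P E) ∧
  (∀ s : ℝ, ∀ ψ ∈ HDom P E, ∀ t : ℝ, ∃ d : 𝓗,
    HasDerivAt (fun τ => U τ s ψ) d t ∧
    ∀ h : 𝓗, IsHSum P E (U t s ψ) h → Complex.I • d = h + V t (U t s ψ))

/-- The Riemann zeta function `ζ(s) = Σ_{n≥1} n^{-s}` (for real `s > 1`). -/
def rzeta (s : ℝ) : ℝ := ∑' n : ℕ+, (((n : ℕ) : ℝ) ^ s)⁻¹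

/-- The constant `C_p = 2^(p+1) (1 + 2 ζ(p-1))`. -/
def Cconst (p : ℝ) : ℝ := 2 ^ (p + 1) * (1 + 2 * rzeta (p - 1))

/-- Growth lemma: if `|⟨f, f'⟩| ≤ K ‖f‖` then `‖f‖` grows at most linearly. -/
lemma norm_growth {F : Type*} [NormedAddCommGroup F] [InnerProductSpace ℝ F]
    (f f' : ℝ → F) (T K : ℝ) (hK : 0 ≤ K)
    (hf : ∀ t, |t| ≤ T → HasDerivAt f (f' t) t)
    (hb : ∀ t, |t| ≤ T → |inner ℝ (f t) (f' t)| ≤ K * ‖f t‖)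
    (t : ℝ) (ht : |t| ≤ T) : ‖f t‖ ≤ ‖f 0‖ + K * |t| := by
  have hT : 0 ≤ T := (abs_nonneg t).trans ht
  refine le_of_forall_pos_le_add fun ε hε => ?_
  have hpos : ∀ s, 0 < ‖f s‖ ^ 2 + ε ^ 2 := fun s => by positivity
  have hd : ∀ s ∈ Set.Icc (-T) T, HasDerivWithinAt (fun s => √(‖f s‖ ^ 2 + ε ^ 2))
      (inner ℝ (f s) (f' s) / √(‖f s‖ ^ 2 + ε ^ 2)) (Set.Icc (-T) T) s := by
    intro s hs
    have h1 := ((hf s (abs_le.2 hs)).norm_sq.add_const (ε ^ 2)).sqrt (hpos s).ne'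
    refine (h1.congr_deriv ?_).hasDerivWithinAt
    have : √(‖f s‖ ^ 2 + ε ^ 2) ≠ 0 := (Real.sqrt_pos.2 (hpos s)).ne'
    field_simp
  have hbd : ∀ s ∈ Set.Icc (-T) T,
      ‖inner ℝ (f s) (f' s) / √(‖f s‖ ^ 2 + ε ^ 2)‖ ≤ K := by
    intro s hs
    have h0 := Real.sqrt_pos.2 (hpos s)
    rw [norm_div, Real.norm_eq_abs, Real.norm_eq_abs, abs_of_pos h0, div_le_iff₀ h0]
    refine (hb s (abs_le.2 hs)).trans (mul_le_mul_of_nonneg_left ?_ hK)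
    exact Real.le_sqrt_of_sq_le (by nlinarith [sq_nonneg ε])
  have h := Convex.norm_image_sub_le_of_norm_hasDerivWithin_le hd hbd (convex_Icc _ _)
    (show (0 : ℝ) ∈ Set.Icc (-T) T from ⟨by linarith, hT⟩) (show t ∈ Set.Icc (-T) T from abs_le.1 ht)
  simp only [sub_zero, Real.norm_eq_abs] at h
  have h1 := (abs_le.1 h).2
  have h2 : ‖f t‖ ≤ √(‖f t‖ ^ 2 + ε ^ 2) := Real.le_sqrt_of_sq_le (by nlinarith [sq_nonneg ε])
  have h3 : √(‖f 0‖ ^ 2 + ε ^ 2) ≤ ‖f 0‖ + ε := by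
    apply Real.sqrt_le_iff.2 ⟨by positivity, ?_⟩
    nlinarith [norm_nonneg (f 0)]
  linarith

lemma tail_sum (s : ℝ) (hs : 1 < s) (N : ℕ) (hN : 1 ≤ N) (F : Finset ℕ+)
    (hF : ∀ n ∈ F, N < (n : ℕ)) :
    ∑ n ∈ F, ((n : ℕ) : ℝ) ^ (-s) ≤ (N : ℝ) ^ (1 - s) / (s - 1) := by
  obtain ⟨b, hb⟩ : ∃ b : ℕ, N ≤ b ∧ ∀ n ∈ F, (n : ℕ) ≤ b := by
    refine ⟨max N (F.sup fun n => (n : ℕ)), le_max_left _ _, fun n hn => ?_⟩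
    exact (Finset.le_sup (f := fun n : ℕ+ => (n : ℕ)) hn).trans (le_max_right _ _)
  have hN' : (0 : ℝ) < N := by exact_mod_cast hN
  have hNb : (N : ℝ) ≤ b := by exact_mod_cast hb.1
  have h1 : ∑ n ∈ F, ((n : ℕ) : ℝ) ^ (-s) ≤ ∑ i ∈ Finset.Ico N b, (((i + 1 : ℕ)) : ℝ) ^ (-s) := by
    have hinj : Set.InjOn (fun n : ℕ+ => (n : ℕ) - 1) (F : Set ℕ+) := by
      intro a _ b _ h
      apply PNat.eq
      have := a.pos
      have := b.pos
      simp only at h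
      omega
    have himg : ∑ n ∈ F, ((n : ℕ) : ℝ) ^ (-s) =
        ∑ i ∈ F.image (fun n : ℕ+ => (n : ℕ) - 1), ((i + 1 : ℕ) : ℝ) ^ (-s) := by
      rw [Finset.sum_image hinj]
      apply Finset.sum_congr rfl
      intro n _
      have : ((n : ℕ) - 1 + 1) = (n : ℕ) := by have := n.pos; omega
      rw [this]
    rw [himg]
    apply Finset.sum_le_sum_of_subset_of_nonneg
    · intro i hi
      simp only [Finset.mem_image] at hi
      obtain ⟨n, hn, rfl⟩ := hi
      have := hF n hn
      have := hb.2 n hn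
      simp only [Finset.mem_Ico]; omega
    · intros; positivity
  have h2 := AntitoneOn.sum_le_integral_Ico (f := fun x : ℝ => x ^ (-s)) hb.1 (by
    intro x hx y hy hxy
    exact Real.rpow_le_rpow_of_nonpos (hN'.trans_le hx.1) hxy (by linarith))
  rw [integral_rpow (Or.inr ⟨by linarith, by
    rw [Set.uIcc_of_le hNb]; intro h; exact absurd h.1 (not_le.2 hN')⟩)] at h2
  refine h1.trans (h2.trans ?_)
  have h3 : 0 ≤ (b : ℝ) ^ (-s + 1) := by positivity
  have h4 : (-s + 1 : ℝ) = 1 - s := by ring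
  rw [h4] at h3 ⊢
  rw [← neg_div_neg_eq]
  have : -(1 - s) = s - 1 := by ring
  rw [this]
  apply div_le_div_of_nonneg_right _ (by linarith)
  linarith

lemma PF_inner {P : ℕ+ → 𝓗 →L[ℂ] 𝓗} (hP : ProjFamily P) (n : ℕ+) (x y : 𝓗) :
    inner ℂ (P n x) y = inner ℂ x (P n y) := by
  have h := hP.1 n
  rw [ContinuousLinearMap.isSelfAdjoint_iff'] at h
  conv_lhs => rw [← h]
  rw [ContinuousLinearMap.adjoint_inner_left]

lemma PF_idem {P : ℕ+ → 𝓗 →L[ℂ] 𝓗} (hP : ProjFamily P) (n : ℕ+) (x : 𝓗) :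
    P n (P n x) = P n x := by
  have := congrArg (fun A : 𝓗 →L[ℂ] 𝓗 => A x) (hP.2.1 n)
  simpa using this

lemma PF_orth {P : ℕ+ → 𝓗 →L[ℂ] 𝓗} (hP : ProjFamily P) (m n : ℕ+) (h : m ≠ n) (x : 𝓗) :
    P m (P n x) = 0 := by
  have := congrArg (fun A : 𝓗 →L[ℂ] 𝓗 => A x) (hP.2.2.1 m n h)
  simpa using this

lemma PF_inner_self {P : ℕ+ → 𝓗 →L[ℂ] 𝓗} (hP : ProjFamily P) (n : ℕ+) (x : 𝓗) :
    inner ℂ x (P n x) = ((‖P n x‖ ^ 2 : ℝ) : ℂ) := by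
  rw [← PF_idem hP n x, ← PF_inner hP, PF_idem hP, inner_self_eq_norm_sq_to_K]
  simp

lemma PF_parseval {P : ℕ+ → 𝓗 →L[ℂ] 𝓗} (hP : ProjFamily P) (x : 𝓗) :
    HasSum (fun n => ‖P n x‖ ^ 2) (‖x‖ ^ 2) := by
  have h := (hP.2.2.2.2 x).mapL (innerSL ℂ x)
  simp only [innerSL_apply_apply, PF_inner_self hP, inner_self_eq_norm_sq_to_K] at h
  have h' := h.mapL Complex.reCLM
  simp only [Complex.reCLM_apply, Complex.ofReal_re] at h'
  convert h' using 1
  norm_cast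

lemma PF_ext {P : ℕ+ → 𝓗 →L[ℂ] 𝓗} (hP : ProjFamily P) {x y : 𝓗}
    (h : ∀ n, P n x = P n y) : x = y := by
  have h1 := hP.2.2.2.2 x
  simp only [h] at h1
  exact h1.unique (hP.2.2.2.2 y)

lemma PF_of_hasSum {P : ℕ+ → 𝓗 →L[ℂ] 𝓗} (hP : ProjFamily P) {a : ℕ+ → ℝ} {x y : 𝓗}
    (h : HasSum (fun n => (a n : ℂ) • P n x) y) (n : ℕ+) : P n y = (a n : ℂ) • P n x := by
  have h1 := h.mapL (P n)
  refine h1.unique ?_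
  convert hasSum_single n ?_ using 1
  · simp [PF_idem hP]
  · intro m hm
    simp [PF_orth hP n m hm.symm]

lemma PF_exists {P : ℕ+ → 𝓗 →L[ℂ] 𝓗} (hP : ProjFamily P) (a : ℕ+ → ℝ) (x : 𝓗)
    (h : Summable fun n => a n ^ 2 * ‖P n x‖ ^ 2) :
    ∃ y, HasSum (fun n => (a n : ℂ) • P n x) y := by
  have hO : OrthogonalFamily ℂ (fun n => (P n).range) fun n => (P n).range.subtypeₗᵢ := by
    intro m n hmn v w
    obtain ⟨_, v, rfl⟩ := v
    obtain ⟨_, w, rfl⟩ := w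
    show inner ℂ (P m v) (P n w) = 0
    rw [PF_inner hP, PF_orth hP m n hmn, inner_zero_right]
  have := (hO.summable_iff_norm_sq_summable
    (fun n => (a n : ℂ) • ⟨P n x, x, rfl⟩)).2 (by
      refine h.congr fun n => ?_
      rw [norm_smul, mul_pow]
      simp)
  obtain ⟨y, hy⟩ := this
  exact ⟨y, by simpa using hy⟩

lemma PF_norm_sq {P : ℕ+ → 𝓗 →L[ℂ] 𝓗} (hP : ProjFamily P) {a : ℕ+ → ℝ} {x y : 𝓗}
    (h : ∀ n, P n y = (a n : ℂ) • P n x) :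
    HasSum (fun n => a n ^ 2 * ‖P n x‖ ^ 2) (‖y‖ ^ 2) := by
  have h1 := PF_parseval hP y
  convert h1 using 2 with n
  rw [h n, norm_smul, mul_pow]
  simp

lemma PF_inner_im {P : ℕ+ → 𝓗 →L[ℂ] 𝓗} (hP : ProjFamily P) {a : ℕ+ → ℝ} {x y : 𝓗}
    (h : HasSum (fun n => (a n : ℂ) • P n x) y) : (inner ℂ x y).im = 0 := by
  have h1 := (h.mapL (innerSL ℂ x)).mapL Complex.imCLM
  simp only [innerSL_apply_apply, inner_smul_right, PF_inner_self hP, Complex.imCLM_apply] at h1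
  refine h1.unique ?_
  convert hasSum_zero with n
  rw [← Complex.ofReal_mul, Complex.ofReal_im]

lemma SA_inner_im {A : 𝓗 →L[ℂ] 𝓗} (hA : IsSelfAdjoint A) (x : 𝓗) : (inner ℂ x (A x)).im = 0 := by
  have := (ContinuousLinearMap.isSelfAdjoint_iff_isSymmetric.1 hA).im_inner_self_apply x
  simpa using this

lemma norm_growthC (f f' : ℝ → 𝓗) (T K : ℝ) (hK : 0 ≤ K)
    (hf : ∀ t, |t| ≤ T → HasDerivAt f (f' t) t)
    (hb : ∀ t, |t| ≤ T → |(inner ℂ (f t) (f' t)).re| ≤ K * ‖f t‖)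
    (t : ℝ) (ht : |t| ≤ T) : ‖f t‖ ≤ ‖f 0‖ + K * |t| := by
  let _ := InnerProductSpace.rclikeToReal ℂ 𝓗
  exact norm_growth f f' T K hK hf (fun s hs => hb s hs) t ht

lemma W_lip {W : ℝ → 𝓗 →L[ℂ] 𝓗} (hW : StrongC1 W) (T : ℝ) :
    ∃ L, 0 ≤ L ∧ ∀ s s', |s| ≤ T → |s'| ≤ T → ‖W s' - W s‖ ≤ L * |s' - s| := by
  let ι := {p : ℝ × ℝ // |p.1| ≤ T ∧ |p.2| ≤ T}
  obtain ⟨L, hL⟩ := banach_steinhaus (ι := ι)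
    (g := fun p => (((p.1.2 - p.1.1)⁻¹ : ℝ) : ℂ) • (W p.1.2 - W p.1.1)) (by
    intro x
    have hc := hW x
    have hd : Continuous (deriv fun t => W t x) := hc.continuous_deriv le_rfl
    obtain ⟨K, hK⟩ := (isCompact_Icc (a := -T) (b := T)).exists_bound_of_continuousOn
      hd.continuousOn
    refine ⟨max K 0, fun p => ?_⟩
    obtain ⟨⟨s, s'⟩, hs, hs'⟩ := p
    simp only at hs hs'
    have := Convex.norm_image_sub_le_of_norm_deriv_le (f := fun t => W t x) (C := K)
      (s := Set.Icc (-T) T) (fun t _ => (hc.differentiable one_ne_zero) t) hK (convex_Icc _ _)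
      (abs_le.1 hs) (abs_le.1 hs')
    simp only [smul_apply, sub_apply, norm_smul,
      Complex.norm_real, norm_inv]
    rcases eq_or_ne s' s with rfl | hne
    · simp
    · have hpos : 0 < ‖s' - s‖ := norm_pos_iff.2 (sub_ne_zero.2 hne)
      rw [inv_mul_le_iff₀ hpos]
      refine this.trans ?_
      rw [mul_comm]
      exact mul_le_mul_of_nonneg_left (le_max_left _ _) hpos.le)
  refine ⟨max L 0, le_max_right _ _, fun s s' hs hs' => ?_⟩
  rcases eq_or_ne s' s with rfl | hne
  · simp
  have h := hL ⟨⟨s, s'⟩, hs, hs'⟩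
  have hpos : 0 < |s' - s| := abs_pos.2 (sub_ne_zero.2 hne)
  simp only [norm_smul, Complex.norm_real, norm_inv, Real.norm_eq_abs] at h
  rw [inv_mul_le_iff₀ hpos] at h
  refine h.trans ?_
  rw [mul_comm]
  exact mul_le_mul_of_nonneg_right (le_max_left _ _) hpos.le

lemma re_inner_aux (f a b g : 𝓗) (ha : (inner ℂ f a).im = 0) (hb : (inner ℂ f b).im = 0) :
    |(inner ℂ f (-Complex.I • (a + b + g))).re| ≤ ‖g‖ * ‖f‖ := by
  have h : (inner ℂ f (-Complex.I • (a + b + g))).re = (inner ℂ f g).im := by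
    rw [inner_smul_right, inner_add_right, inner_add_right]
    simp [ha, hb]
  rw [h, mul_comm]
  exact (Complex.abs_im_le_norm _).trans (norm_inner_le_norm _ _)

lemma apriori {P : ℕ+ → 𝓗 →L[ℂ] 𝓗} (hP : ProjFamily P) {E : ℕ+ → ℝ}
    {W : ℝ → 𝓗 →L[ℂ] 𝓗} (hWsa : ∀ t, IsSelfAdjoint (W t)) (hW : StrongC1 W)
    (x h : ℝ → 𝓗) (R : ℝ) (hR : ∀ t, ‖x t‖ = R)
    (hx : ∀ t, HasDerivAt x (-Complex.I • (h t + W t (x t))) t)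
    (hh : ∀ t, IsHSum P E (x t) (h t)) (T : ℝ) (hT : 0 ≤ T) :
    ∃ M, ∀ t, |t| ≤ T → ‖h t‖ ≤ M := by
  obtain ⟨L, hL0, hL⟩ := W_lip hW (T + 1)
  have hR0 : 0 ≤ R := by rw [← hR 0]; exact norm_nonneg _
  obtain ⟨D, hD⟩ := (hx 0).isBigO_sub.bound
  have key : ∀ t, |t| ≤ T → ∀ δ, |δ| ≤ 1 →
      ‖x (t + δ) - x t‖ ≤ ‖x δ - x 0‖ + L * |δ| * R * T := by
    intro t ht δ hδ
    have := norm_growthC (fun s => x (s + δ) - x s)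
      (fun s => -Complex.I • (h (s + δ) + W (s + δ) (x (s + δ)))
        - -Complex.I • (h s + W s (x s))) T (L * |δ| * R) (by positivity)
      (fun s _ => ((hx (s + δ)).comp_add_const s δ).sub (hx s)) (by
        intro s hs
        have e : -Complex.I • (h (s + δ) + W (s + δ) (x (s + δ)))
            - -Complex.I • (h s + W s (x s)) = -Complex.I •
            ((h (s + δ) - h s) + W s (x (s + δ) - x s) + (W (s + δ) - W s) (x (s + δ))) := by
          rw [← smul_sub]
          congr 1
          simp only [map_sub, sub_apply]
          abel
        simp only [e]
        refine (re_inner_aux _ _ _ _ ?_ (SA_inner_im (hWsa s) _)).trans ?_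
        · refine PF_inner_im hP (a := E) ?_
          have := (hh (s + δ)).sub (hh s)
          simpa only [map_sub, smul_sub] using this
        · refine mul_le_mul_of_nonneg_right ?_ (norm_nonneg _)
          refine (ContinuousLinearMap.le_opNorm _ _).trans ?_
          rw [hR]
          refine mul_le_mul_of_nonneg_right ?_ hR0
          have := hL s (s + δ) (by linarith) ((abs_add_le _ _).trans (by linarith))
          simpa using this) t ht
    simp only [zero_add] at this
    refine this.trans ?_
    gcongr
  have hd : ∀ t, |t| ≤ T → ‖-Complex.I • (h t + W t (x t))‖ ≤ |D| + L * R * T := by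
    intro t ht
    refine (hx t).le_of_lip' (by positivity) ?_
    have h1 : ∀ᶠ δ : ℝ in nhds 0, |δ| ≤ 1 := by
      have := Metric.closedBall_mem_nhds (0 : ℝ) one_pos
      filter_upwards [this] with δ hδ
      simpa using hδ
    have h2 : Filter.Tendsto (fun s => s - t) (nhds t) (nhds 0) := by
      have : Continuous fun s : ℝ => s - t := by fun_prop
      simpa using this.tendsto t
    filter_upwards [h2.eventually h1, h2.eventually hD] with s hs1 hs2
    have h3 := key t ht (s - t) hs1
    rw [add_sub_cancel] at h3
    simp only [sub_zero, Real.norm_eq_abs] at hs2 ⊢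
    have := mul_le_mul_of_nonneg_right (le_abs_self D) (abs_nonneg (s - t))
    calc _ ≤ _ := h3
      _ ≤ |D| * |s - t| + L * |s - t| * R * T := by linarith
      _ = _ := by ring
  refine ⟨|D| + L * R * T + (‖W 0‖ + L * T) * R, fun t ht => ?_⟩
  have h1 := hd t ht
  rw [norm_smul, norm_neg, Complex.norm_I, one_mul] at h1
  have h2 : ‖W t‖ ≤ ‖W 0‖ + L * T := by
    have := hL 0 t (by simp; linarith) (by linarith)
    rw [sub_zero] at this
    have h3 := norm_le_norm_add_norm_sub' (W t) (W 0)
    have h4 : L * |t| ≤ L * T := by gcongr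
    linarith
  have h3 : ‖W t (x t)‖ ≤ (‖W 0‖ + L * T) * R := by
    refine (ContinuousLinearMap.le_opNorm _ _).trans ?_
    rw [hR]
    gcongr
  have h4 : ‖h t‖ ≤ ‖h t + W t (x t)‖ + ‖W t (x t)‖ := by
    simpa using norm_sub_le (h t + W t (x t)) (W t (x t))
  linarith

lemma QDom_of_HDom {P : ℕ+ → 𝓗 →L[ℂ] 𝓗} {E : ℕ+ → ℝ} (hE1 : 0 < E 1) (hEmono : StrictMono E)
    {x : 𝓗} (hx : x ∈ HDom P E) : Summable (fun n => E n * ‖P n x‖ ^ 2) ∧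
      ∑' n, E n * ‖P n x‖ ^ 2 ≤ (E 1)⁻¹ * ∑' n, E n ^ 2 * ‖P n x‖ ^ 2 := by
  have hge : ∀ n, E 1 ≤ E n := fun n => hEmono.monotone one_le
  have hx' : Summable fun n => (E 1)⁻¹ * (E n ^ 2 * ‖P n x‖ ^ 2) := Summable.mul_left _ hx
  have hle : ∀ n, E n * ‖P n x‖ ^ 2 ≤ (E 1)⁻¹ * (E n ^ 2 * ‖P n x‖ ^ 2) := by
    intro n
    have h0 := hge n
    have hpos : 0 < E n := hE1.trans_le h0
    rw [← mul_assoc]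
    apply mul_le_mul_of_nonneg_right _ (by positivity)
    rw [le_inv_mul_iff₀ hE1]
    nlinarith
  have hs : Summable (fun n => E n * ‖P n x‖ ^ 2) :=
    Summable.of_nonneg_of_le (fun n => mul_nonneg (hE1.le.trans (hge n)) (by positivity)) hle hx'
  refine ⟨hs, ?_⟩
  rw [← tsum_mul_left]
  exact hs.tsum_le_tsum hle hx'

lemma PWQ_bound {P : ℕ+ → 𝓗 →L[ℂ] 𝓗} (hP : ProjFamily P) {E : ℕ+ → ℝ} (hEpos : ∀ n, 0 < E n)
    (Hih : 𝓗 →L[ℂ] 𝓗)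
    (hHih : ∀ ψ : 𝓗, HasSum (fun n => ((E n ^ (-(1 : ℝ) / 2) : ℝ) : ℂ) • P n ψ) (Hih ψ))
    (A : 𝓗 →L[ℂ] 𝓗) (n : ℕ+) (k : ℝ) (hk : ‖(P n).comp (A.comp ((1 - P n).comp Hih))‖ ≤ k)
    (x : 𝓗) (hx : Summable fun n => E n * ‖P n x‖ ^ 2) (M : ℝ)
    (hM : ∑' n, E n * ‖P n x‖ ^ 2 ≤ M) :
    ‖P n (A (x - P n x))‖ ≤ k * √M := by
  have hsq : ∀ n, √(E n) ^ 2 = E n := fun n => Real.sq_sqrt (hEpos n).le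
  obtain ⟨y, hy⟩ := PF_exists hP (fun n => √(E n)) x (by simpa only [hsq] using hx)
  have hy' := PF_of_hasSum hP hy
  have hyn := PF_norm_sq hP hy'
  simp only [hsq] at hyn
  have hyM : ‖y‖ ≤ √M := Real.le_sqrt_of_sq_le (by rw [← hyn.tsum_eq]; exact hM)
  have hxy : Hih y = x := by
    refine PF_ext hP fun m => ?_
    rw [PF_of_hasSum hP (hHih y) m, hy', smul_smul, ← Complex.ofReal_mul, Real.sqrt_eq_rpow,
      ← Real.rpow_add (hEpos m)]
    norm_num
  have h := ((P n).comp (A.comp ((1 - P n).comp Hih))).le_opNorm y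
  simp only [ContinuousLinearMap.comp_apply, sub_apply, one_apply_eq_self, hxy] at h
  exact h.trans (mul_le_mul hk hyM (norm_nonneg _) ((norm_nonneg _).trans hk))

lemma comp_growth {P : ℕ+ → 𝓗 →L[ℂ] 𝓗} (hP : ProjFamily P) {E : ℕ+ → ℝ}
    {W : ℝ → 𝓗 →L[ℂ] 𝓗} (hWsa : ∀ t, IsSelfAdjoint (W t))
    (x h : ℝ → 𝓗)
    (hx : ∀ t, HasDerivAt x (-Complex.I • (h t + W t (x t))) t)
    (hh : ∀ t, IsHSum P E (x t) (h t)) (T : ℝ) (n : ℕ+) (K : ℝ) (hK : 0 ≤ K)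
    (hb : ∀ t, |t| ≤ T → ‖P n (W t (x t - P n (x t)))‖ ≤ K) (t : ℝ) (ht : |t| ≤ T) :
    ‖P n (x t)‖ ≤ ‖P n (x 0)‖ + K * |t| := by
  refine norm_growthC (fun s => P n (x s)) (fun s => P n (-Complex.I • (h s + W s (x s)))) T K hK
    (fun s _ => ((P n).restrictScalars ℝ).hasFDerivAt.comp_hasDerivAt s (hx s)) ?_ t ht
  intro s hs
  have e : P n (-Complex.I • (h s + W s (x s))) = -Complex.I •
      ((E n : ℂ) • P n (x s) + P n (W s (P n (x s))) + P n (W s (x s - P n (x s)))) := by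
    rw [map_smul, map_add, PF_of_hasSum hP (hh s) n, map_sub, map_sub]
    congr 1
    abel
  simp only [e]
  refine (re_inner_aux _ _ _ _ ?_ ?_).trans (mul_le_mul_of_nonneg_right (hb s hs) (norm_nonneg _))
  · rw [inner_smul_right, Complex.im_ofReal_mul]
    exact mul_eq_zero_of_right _ (inner_self_im (𝕜 := ℂ) _)
  · rw [← PF_inner hP, PF_idem hP]
    exact SA_inner_im (hWsa s) _

/-- One step of the bootstrap. -/
lemma step {P : ℕ+ → 𝓗 →L[ℂ] 𝓗} (hP : ProjFamily P)
    {E : ℕ+ → ℝ} (hEpos : ∀ n, 0 < E n)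
    {α C : ℝ} (hα : 0 < α) (hC : 0 < C)
    (hE : ∀ n : ℕ+, E n ≤ C * ((n : ℕ) : ℝ) ^ α)
    {μ c : ℝ} (hμ : 1 / 2 < μ) (hc : 0 < c) (K : ℝ) (hK1 : 1 ≤ K)
    (hK : 8 * C * c ^ 2 / (2 * μ - 1) ≤ K ^ (2 * μ - 1))
    (x x₀ : 𝓗) (hx₀ : Summable fun n => E n * ‖P n x₀‖ ^ 2) (T M : ℝ) (hT : 1 ≤ T) (hM : 0 ≤ M)
    (hg : ∀ n : ℕ+, ‖P n x‖ ≤ ‖P n x₀‖ + c * ((n : ℕ) : ℝ) ^ (-μ - α / 2) * √M * T)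
    (F : Finset ℕ+) :
    ∑ n ∈ F, E n * ‖P n x‖ ^ 2 ≤ C * (2 * K) ^ α * T ^ (2 * α / (2 * μ - 1)) * ‖x‖ ^ 2
      + 2 * ∑' n, E n * ‖P n x₀‖ ^ 2 + M / 2 := by
  have hν : 0 < 2 * μ - 1 := by linarith
  have hT0 : 0 < T := by linarith
  have hK0 : 0 < K := by linarith
  set R := K * T ^ (2 / (2 * μ - 1)) with hR
  have hR1 : 1 ≤ R := one_le_mul_of_one_le_of_one_le hK1 (Real.one_le_rpow hT (by positivity))
  set N := ⌈R⌉₊ with hNdef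
  have hRN : R ≤ N := Nat.le_ceil R
  have hN1 : 1 ≤ N := by
    have : (1 : ℝ) ≤ N := hR1.trans hRN
    exact_mod_cast this
  have hN2 : (N : ℝ) ≤ 2 * R := by
    have := Nat.ceil_lt_add_one (show 0 ≤ R by linarith)
    linarith
  have hNα : (N : ℝ) ^ α ≤ (2 * K) ^ α * T ^ (2 * α / (2 * μ - 1)) := by
    calc (N : ℝ) ^ α ≤ (2 * R) ^ α := Real.rpow_le_rpow (by positivity) hN2 hα.le
      _ = _ := by
        rw [hR, ← mul_assoc, Real.mul_rpow (by positivity) (by positivity), ← Real.rpow_mul hT0.le]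
        congr 2
        ring
  have hNt : (N : ℝ) ^ (1 - 2 * μ) / (2 * μ - 1) * (2 * C * c ^ 2 * T ^ 2 * M) ≤ M / 2 := by
    have h1 : (N : ℝ) ^ (1 - 2 * μ) ≤ R ^ (1 - 2 * μ) :=
      Real.rpow_le_rpow_of_nonpos (by linarith) hRN (by linarith)
    have h2 : R ^ (1 - 2 * μ) = (K ^ (2 * μ - 1))⁻¹ * (T ^ 2)⁻¹ := by
      rw [hR, Real.mul_rpow hK0.le (by positivity), ← Real.rpow_mul hT0.le,
        ← Real.rpow_neg hK0.le]
      have e1 : -(2 * μ - 1) = 1 - 2 * μ := by ring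
      have e2 : 2 / (2 * μ - 1) * (1 - 2 * μ) = -2 := by field_simp; ring
      rw [e1, e2, Real.rpow_neg hT0.le]
      norm_cast
    rw [h2] at h1
    have hKp : 0 < K ^ (2 * μ - 1) := by positivity
    rw [div_le_iff₀ hν] at hK
    calc _ ≤ ((K ^ (2 * μ - 1))⁻¹ * (T ^ 2)⁻¹) / (2 * μ - 1) * (2 * C * c ^ 2 * T ^ 2 * M) := by
          gcongr
      _ = (2 * C * c ^ 2) / (K ^ (2 * μ - 1) * (2 * μ - 1)) * M := by field_simp
      _ ≤ (1 / 2) * M := by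
          apply mul_le_mul_of_nonneg_right _ hM
          rw [div_le_iff₀ (by positivity)]
          have : 0 ≤ C * c ^ 2 := by positivity
          linarith
      _ = M / 2 := by ring
  have hlow : ∑ n ∈ F.filter (fun n : ℕ+ => (n : ℕ) ≤ N), E n * ‖P n x‖ ^ 2 ≤
      C * (2 * K) ^ α * T ^ (2 * α / (2 * μ - 1)) * ‖x‖ ^ 2 := by
    calc _ ≤ ∑ n ∈ F.filter (fun n : ℕ+ => (n : ℕ) ≤ N), (C * (N : ℝ) ^ α) * ‖P n x‖ ^ 2 := by
          apply Finset.sum_le_sum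
          intro n hn
          have hn' : (n : ℕ) ≤ N := (Finset.mem_filter.1 hn).2
          refine mul_le_mul_of_nonneg_right ((hE n).trans ?_) (by positivity)
          gcongr
      _ ≤ (C * (N : ℝ) ^ α) * ‖x‖ ^ 2 := by
          rw [← Finset.mul_sum]
          refine mul_le_mul_of_nonneg_left ?_ (by positivity)
          exact sum_le_hasSum _ (fun _ _ => by positivity) (PF_parseval hP x)
      _ ≤ _ := by
          refine mul_le_mul_of_nonneg_right ?_ (by positivity)
          rw [mul_assoc]
          gcongr
  have hhigh : ∑ n ∈ F.filter (fun n : ℕ+ => ¬ (n : ℕ) ≤ N), E n * ‖P n x‖ ^ 2 ≤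
      2 * ∑' n, E n * ‖P n x₀‖ ^ 2 + M / 2 := by
    calc _ ≤ ∑ n ∈ F.filter (fun n : ℕ+ => ¬ (n : ℕ) ≤ N), (2 * (E n * ‖P n x₀‖ ^ 2) +
            ((n : ℕ) : ℝ) ^ (-(2 * μ)) * (2 * C * c ^ 2 * T ^ 2 * M)) := by
          apply Finset.sum_le_sum
          intro n hn
          have hn0 : (0 : ℝ) < (n : ℕ) := by exact_mod_cast n.pos
          set p := ((n : ℕ) : ℝ) ^ (-μ - α / 2) with hp
          have hpp : ((n : ℕ) : ℝ) ^ α * p ^ 2 = ((n : ℕ) : ℝ) ^ (-(2 * μ)) := by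
            rw [hp, ← Real.rpow_natCast, ← Real.rpow_mul hn0.le, ← Real.rpow_add hn0]
            congr 1
            push_cast
            ring
          have hsM : √M ^ 2 = M := Real.sq_sqrt hM
          have h1 : ‖P n x‖ ^ 2 ≤ 2 * ‖P n x₀‖ ^ 2 + 2 * (c * p * √M * T) ^ 2 := by
            have := pow_le_pow_left₀ (norm_nonneg _) (hg n) 2
            nlinarith [sq_nonneg (‖P n x₀‖ - c * p * √M * T)]
          calc E n * ‖P n x‖ ^ 2 ≤ E n * (2 * ‖P n x₀‖ ^ 2 + 2 * (c * p * √M * T) ^ 2) :=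
                mul_le_mul_of_nonneg_left h1 (hEpos n).le
            _ = 2 * (E n * ‖P n x₀‖ ^ 2) + E n * (2 * c ^ 2 * p ^ 2 * (√M ^ 2) * T ^ 2) := by ring
            _ ≤ 2 * (E n * ‖P n x₀‖ ^ 2) +
                (C * ((n : ℕ) : ℝ) ^ α) * (2 * c ^ 2 * p ^ 2 * (√M ^ 2) * T ^ 2) := by
                gcongr
                exact hE n
            _ = _ := by rw [hsM, ← hpp]; ring
      _ = 2 * ∑ n ∈ F.filter (fun n : ℕ+ => ¬ (n : ℕ) ≤ N), (E n * ‖P n x₀‖ ^ 2) +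
          (∑ n ∈ F.filter (fun n : ℕ+ => ¬ (n : ℕ) ≤ N), ((n : ℕ) : ℝ) ^ (-(2 * μ))) *
            (2 * C * c ^ 2 * T ^ 2 * M) := by
          rw [Finset.sum_add_distrib, Finset.mul_sum, Finset.sum_mul]
      _ ≤ 2 * ∑' n, E n * ‖P n x₀‖ ^ 2 +
          (N : ℝ) ^ (1 - 2 * μ) / (2 * μ - 1) * (2 * C * c ^ 2 * T ^ 2 * M) := by
          gcongr
          · exact hx₀.sum_le_tsum _ (fun n _ => mul_nonneg (hEpos n).le (by positivity))
          · exact tail_sum (2 * μ) (by linarith) N hN1 _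
              (fun n hn => not_le.1 (Finset.mem_filter.1 hn).2)
      _ ≤ _ := by linarith
  rw [← Finset.sum_filter_add_sum_filter_not F (fun n : ℕ+ => (n : ℕ) ≤ N)]
  linarith

lemma unit_norm {A : 𝓗 →L[ℂ] 𝓗} (hA : IsUnitaryOp A) (x : 𝓗) : ‖A x‖ = ‖x‖ := by
  have h : star A (A x) = x := by
    have := congrArg (fun B : 𝓗 →L[ℂ] 𝓗 => B x) hA.2
    simpa using this
  have h1 : ‖A x‖ ^ 2 = ‖x‖ ^ 2 := by
    have h2 : inner ℂ (A x) (A x) = inner ℂ x x := by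
      rw [← ContinuousLinearMap.adjoint_inner_right, ← ContinuousLinearMap.star_eq_adjoint, h]
    rw [inner_self_eq_norm_sq_to_K, inner_self_eq_norm_sq_to_K] at h2
    exact_mod_cast h2
  exact (sq_eq_sq₀ (norm_nonneg _) (norm_nonneg _)).1 h1

lemma energy_HDom
    (P : ℕ+ → 𝓗 →L[ℂ] 𝓗) (hP : ProjFamily P)
    (E : ℕ+ → ℝ) (hE1 : 0 < E 1) (hEmono : StrictMono E)
    (α C : ℝ) (hα : 0 < α) (hC : 0 < C)
    (hE : ∀ n : ℕ+, E n ≤ C * ((n : ℕ) : ℝ) ^ α)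
    (Hih : 𝓗 →L[ℂ] 𝓗)
    (hHih : ∀ ψ : 𝓗, HasSum (fun n => ((E n ^ (-(1 : ℝ) / 2) : ℝ) : ℂ) • P n ψ) (Hih ψ))
    (W : ℝ → 𝓗 →L[ℂ] 𝓗) (hWsa : ∀ t, IsSelfAdjoint (W t)) (hWc1 : StrongC1 W)
    (μ c : ℝ) (hμ : 1 / 2 < μ) (hc : 0 < c)
    (hW : ∀ (n : ℕ+) (t : ℝ),
      ‖(P n).comp ((W t).comp ((1 - P n).comp Hih))‖ ≤ c * ((n : ℕ) : ℝ) ^ (-μ - α / 2))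
    (U : ℝ → ℝ → 𝓗 →L[ℂ] 𝓗) (hU : IsPropagator P E W U) :
    ∃ c₃ > 0, ∀ ψ ∈ HDom P E, ∀ T : ℝ, 1 ≤ T → ∀ t, |t| ≤ T → ∀ F : Finset ℕ+,
      ∑ n ∈ F, E n * ‖P n (U t 0 ψ)‖ ^ 2 ≤
        c₃ * (T ^ (2 * α / (2 * μ - 1)) * ‖ψ‖ ^ 2 + ∑' n : ℕ+, E n * ‖P n ψ‖ ^ 2) := by
  have hν : 0 < 2 * μ - 1 := by linarith
  have hEpos : ∀ n, 0 < E n := fun n => hE1.trans_le (hEmono.monotone one_le)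
  obtain ⟨hun, -, hU1, -, hdom, hder⟩ := hU
  obtain ⟨K, hK1, hK⟩ : ∃ K : ℝ, 1 ≤ K ∧ 8 * C * c ^ 2 / (2 * μ - 1) ≤ K ^ (2 * μ - 1) := by
    refine ⟨max 1 ((8 * C * c ^ 2 / (2 * μ - 1)) ^ (1 / (2 * μ - 1))), le_max_left _ _, ?_⟩
    have h0 : 0 ≤ 8 * C * c ^ 2 / (2 * μ - 1) := by positivity
    calc 8 * C * c ^ 2 / (2 * μ - 1)
        = ((8 * C * c ^ 2 / (2 * μ - 1)) ^ (1 / (2 * μ - 1))) ^ (2 * μ - 1) := by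
          rw [← Real.rpow_mul h0, one_div_mul_cancel hν.ne', Real.rpow_one]
      _ ≤ _ := Real.rpow_le_rpow (by positivity) (le_max_right _ _) hν.le
  have hK0 : 0 < K := by linarith
  refine ⟨2 * (C * (2 * K) ^ α) + 4, by positivity, ?_⟩
  intro ψ hψ T hT
  have hxdom : ∀ t, U t 0 ψ ∈ HDom P E := fun t => by
    rw [← hdom t 0]; exact ⟨ψ, hψ, rfl⟩
  have hex : ∀ t, ∃ h, IsHSum P E (U t 0 ψ) h := fun t => PF_exists hP E _ (hxdom t)
  choose h hh using hex
  have hx : ∀ t, HasDerivAt (fun t => U t 0 ψ) (-Complex.I • (h t + W t (U t 0 ψ))) t := by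
    intro t
    obtain ⟨d, hd, hd2⟩ := hder 0 ψ hψ t
    rw [← hd2 (h t) (hh t), smul_smul]
    simpa using hd
  have hR : ∀ t, ‖U t 0 ψ‖ = ‖ψ‖ := fun t => unit_norm (hun t 0) ψ
  have hx0 : U 0 0 ψ = ψ := by rw [hU1]; rfl
  obtain ⟨M₀, hM₀⟩ := apriori hP hWsa hWc1 (fun t => U t 0 ψ) h ‖ψ‖ hR hx hh T (by linarith)
  set X : ℝ → ℝ := fun t => ∑' n, E n * ‖P n (U t 0 ψ)‖ ^ 2 with hX
  have hsum : ∀ t, Summable fun n => E n * ‖P n (U t 0 ψ)‖ ^ 2 := fun t =>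
    (QDom_of_HDom hE1 hEmono (hxdom t)).1
  have hXb : ∀ t, |t| ≤ T → X t ≤ (E 1)⁻¹ * M₀ ^ 2 := by
    intro t ht
    refine (QDom_of_HDom hE1 hEmono (hxdom t)).2.trans ?_
    have h1 := (PF_norm_sq hP (fun n => PF_of_hasSum hP (hh t) n)).tsum_eq
    rw [h1]
    have := hM₀ t ht
    gcongr
  have hX0 : ∀ t, 0 ≤ X t := fun t =>
    tsum_nonneg fun n => mul_nonneg (hEpos n).le (by positivity)
  set S : Set ℝ := X '' {t | |t| ≤ T} with hS
  have hSb : BddAbove S := ⟨(E 1)⁻¹ * M₀ ^ 2, by rintro _ ⟨t, ht, rfl⟩; exact hXb t ht⟩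
  have hSn : S.Nonempty := ⟨X 0, 0, by simp; linarith, rfl⟩
  set M := sSup S with hM
  have hXM : ∀ t, |t| ≤ T → X t ≤ M := fun t ht => le_csSup hSb ⟨t, ht, rfl⟩
  have hMnn : 0 ≤ M := (hX0 0).trans (hXM 0 (by simp; linarith))
  have hψsum : Summable fun n => E n * ‖P n ψ‖ ^ 2 := (QDom_of_HDom hE1 hEmono hψ).1
  have hstep : ∀ t, |t| ≤ T → ∀ F : Finset ℕ+, ∑ n ∈ F, E n * ‖P n (U t 0 ψ)‖ ^ 2 ≤
      C * (2 * K) ^ α * T ^ (2 * α / (2 * μ - 1)) * ‖ψ‖ ^ 2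
      + 2 * ∑' n, E n * ‖P n ψ‖ ^ 2 + M / 2 := by
    intro t ht F
    have := step hP hEpos hα hC hE hμ hc K hK1 hK (U t 0 ψ) ψ hψsum T M hT hMnn (by
      intro n
      have hb : 0 ≤ c * ((n : ℕ) : ℝ) ^ (-μ - α / 2) * √M := by positivity
      have h1 := comp_growth hP hWsa (fun t => U t 0 ψ) h hx hh T n
        (c * ((n : ℕ) : ℝ) ^ (-μ - α / 2) * √M) hb (fun s hs =>
          PWQ_bound hP hEpos Hih hHih (W s) n _ (hW n s) _ (hsum s) M (hXM s hs)) t ht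
      simp only [hx0] at h1
      exact h1.trans (by gcongr)) F
    rwa [hR] at this
  have hMle : M ≤ C * (2 * K) ^ α * T ^ (2 * α / (2 * μ - 1)) * ‖ψ‖ ^ 2
      + 2 * ∑' n, E n * ‖P n ψ‖ ^ 2 + M / 2 := by
    refine csSup_le hSn ?_
    rintro _ ⟨t, ht, rfl⟩
    exact (hsum t).tsum_le_of_sum_le (hstep t ht)
  intro t ht F
  refine ((hsum t).sum_le_tsum F fun n _ => mul_nonneg (hEpos n).le (by positivity)).trans ?_
  refine (hXM t ht).trans ?_
  have hY : 0 ≤ ∑' n, E n * ‖P n ψ‖ ^ 2 :=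
    tsum_nonneg fun n => mul_nonneg (hEpos n).le (by positivity)
  have hZ : 0 ≤ T ^ (2 * α / (2 * μ - 1)) * ‖ψ‖ ^ 2 := by positivity
  have hA : 0 ≤ C * (2 * K) ^ α := by positivity
  have := mul_nonneg hA hY
  have hM2 : M ≤ 2 * (C * (2 * K) ^ α * (T ^ (2 * α / (2 * μ - 1)) * ‖ψ‖ ^ 2))
      + 4 * ∑' n, E n * ‖P n ψ‖ ^ 2 := by
    rw [← mul_assoc (C * (2 * K) ^ α)]
    linarith
  nlinarith

lemma energy_QDom
    (P : ℕ+ → 𝓗 →L[ℂ] 𝓗) (hP : ProjFamily P)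
    (E : ℕ+ → ℝ) (hEpos : ∀ n, 0 < E n)
    (A : 𝓗 →L[ℂ] 𝓗) (c₃ b : ℝ) (hc₃ : 0 < c₃) (hb : 0 ≤ b)
    (h : ∀ ψ ∈ HDom P E, ∀ F : Finset ℕ+,
      ∑ n ∈ F, E n * ‖P n (A ψ)‖ ^ 2 ≤ c₃ * (b * ‖ψ‖ ^ 2 + ∑' n : ℕ+, E n * ‖P n ψ‖ ^ 2)) :
    ∀ ψ ∈ QDom P E, ∀ F : Finset ℕ+,
      ∑ n ∈ F, E n * ‖P n (A ψ)‖ ^ 2 ≤ c₃ * (b * ‖ψ‖ ^ 2 + ∑' n : ℕ+, E n * ‖P n ψ‖ ^ 2) := by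
  intro ψ hψ F
  have hψ' : Summable fun n => E n * ‖P n ψ‖ ^ 2 := hψ
  have hlim : Filter.Tendsto (fun G : Finset ℕ+ => ∑ m ∈ G, P m ψ) Filter.atTop (nhds ψ) :=
    hP.2.2.2.2 ψ
  have hcont : Continuous fun φ : 𝓗 => ∑ n ∈ F, E n * ‖P n (A φ)‖ ^ 2 := by fun_prop
  refine le_of_tendsto ((hcont.tendsto ψ).comp hlim) (Filter.Eventually.of_forall fun G => ?_)
  simp only [Function.comp_apply]
  have hPG : ∀ n, P n (∑ m ∈ G, P m ψ) = if n ∈ G then P n ψ else 0 := by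
    intro n
    rw [map_sum]
    split_ifs with hn
    · rw [Finset.sum_eq_single n, PF_idem hP]
      · intro m _ hm
        exact PF_orth hP n m hm.symm ψ
      · exact fun h => absurd hn h
    · exact Finset.sum_eq_zero fun m hm => PF_orth hP n m (by rintro rfl; exact hn hm) ψ
  have hle : ∀ n, ‖P n (∑ m ∈ G, P m ψ)‖ ^ 2 ≤ ‖P n ψ‖ ^ 2 := by
    intro n
    rw [hPG]
    split_ifs
    · exact le_rfl
    · simp
  have hmem : (∑ m ∈ G, P m ψ) ∈ HDom P E := by
    refine summable_of_ne_finset_zero (s := G) fun n hn => ?_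
    rw [hPG, if_neg hn]
    simp
  refine (h _ hmem F).trans ?_
  have h1 : ‖∑ m ∈ G, P m ψ‖ ^ 2 ≤ ‖ψ‖ ^ 2 :=
    hasSum_le hle (PF_parseval hP _) (PF_parseval hP ψ)
  have hle' : ∀ n, E n * ‖P n (∑ m ∈ G, P m ψ)‖ ^ 2 ≤ E n * ‖P n ψ‖ ^ 2 := fun n =>
    mul_le_mul_of_nonneg_left (hle n) (hEpos n).le
  have h2 : ∑' n, E n * ‖P n (∑ m ∈ G, P m ψ)‖ ^ 2 ≤ ∑' n, E n * ‖P n ψ‖ ^ 2 :=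
    (Summable.of_nonneg_of_le (fun n => mul_nonneg (hEpos n).le (by positivity)) hle'
      hψ').tsum_le_tsum hle' hψ'
  gcongr

/-- Theorem 3.2: energy growth bound for perturbations whose off-diagonal
part decays fast enough, relative to `H^{-1/2}`. -/
theorem statement1
    (P : ℕ+ → 𝓗 →L[ℂ] 𝓗) (hP : ProjFamily P)
    (E : ℕ+ → ℝ) (hE1 : 0 < E 1) (hEmono : StrictMono E)
    (α C : ℝ) (hα : 0 < α) (hC : 0 < C)
    (hE : ∀ n : ℕ+, E n ≤ C * ((n : ℕ) : ℝ) ^ α)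
    (Hih : 𝓗 →L[ℂ] 𝓗)
    (hHih : ∀ ψ : 𝓗, HasSum (fun n => ((E n ^ (-(1 : ℝ) / 2) : ℝ) : ℂ) • P n ψ) (Hih ψ))
    (W : ℝ → 𝓗 →L[ℂ] 𝓗) (hWsa : ∀ t, IsSelfAdjoint (W t)) (hWc1 : StrongC1 W)
    (μ c : ℝ) (hμ : 1 / 2 < μ) (hc : 0 < c)
    (hW : ∀ (n : ℕ+) (t : ℝ),
      ‖(P n).comp ((W t).comp ((1 - P n).comp Hih))‖ ≤ c * ((n : ℕ) : ℝ) ^ (-μ - α / 2))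
    (U : ℝ → ℝ → 𝓗 →L[ℂ] 𝓗) (hU : IsPropagator P E W U) :
    (∀ t : ℝ, ∀ ψ ∈ QDom P E, U t 0 ψ ∈ QDom P E) ∧
    ∃ c₃ > 0, ∀ ψ ∈ QDom P E, ∀ t : ℝ, 1 ≤ t →
      ∑' n : ℕ+, E n * ‖P n (U t 0 ψ)‖ ^ 2 ≤
        c₃ * (t ^ (2 * α / (2 * μ - 1)) * ‖ψ‖ ^ 2 + ∑' n : ℕ+, E n * ‖P n ψ‖ ^ 2) := by
  have hEpos : ∀ n, 0 < E n := fun n => hE1.trans_le (hEmono.monotone one_le)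
  obtain ⟨c₃, hc₃, hmain⟩ := energy_HDom P hP E hE1 hEmono α C hα hC hE Hih hHih W hWsa hWc1
    μ c hμ hc hW U hU
  have key : ∀ T : ℝ, 1 ≤ T → ∀ t, |t| ≤ T → ∀ ψ ∈ QDom P E, ∀ F : Finset ℕ+,
      ∑ n ∈ F, E n * ‖P n (U t 0 ψ)‖ ^ 2 ≤
        c₃ * (T ^ (2 * α / (2 * μ - 1)) * ‖ψ‖ ^ 2 + ∑' n : ℕ+, E n * ‖P n ψ‖ ^ 2) := by
    intro T hT t ht
    have hT0 : 0 ≤ T := by linarith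
    exact energy_QDom P hP E hEpos (U t 0) c₃ _ hc₃ (by positivity)
      (fun ψ hψ F => hmain ψ hψ T hT t ht F)
  have hQ : ∀ t : ℝ, ∀ ψ ∈ QDom P E, U t 0 ψ ∈ QDom P E := by
    intro t ψ hψ
    exact summable_of_sum_le (fun n => mul_nonneg (hEpos n).le (by positivity))
      (key (max 1 |t|) (le_max_left _ _) t (le_max_right _ _) ψ hψ)
  refine ⟨hQ, c₃, hc₃, fun ψ hψ t ht => ?_⟩
  have hs : Summable fun n => E n * ‖P n (U t 0 ψ)‖ ^ 2 := hQ t ψ hψ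
  exact hs.tsum_le_of_sum_le (key t ht t (abs_of_nonneg (by linarith)).le ψ hψ)

end
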